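/- Let H be a real Hilbert space of finite dimension d and let G : S(H) → A(H) be a linear diagonalizable map whose constant matrix-eigenvalue (g_{i,j}) satisfies the sign condition (there exist signs ε_ℓ with ε_ℓ g_{ℓ,k} ≥ 0 for k ≥ ℓ) and g_{ℓ,j} ≠ 0 for j ≠ ℓ. Let H₀ be symmetric with simple eigenvalues, and let H_∞ = diag(α_ℓ) be the limit of the solution of H' = [H, G(H)], H(0) = H₀. Then there exist T, C > 0 such that for all t ≥ T, ‖H(t) − H_∞‖ ≤ C e^{−γt}, where γ = inf over T⁻ of |g_{i,j}(α_i − α_j)| > 0 and T⁻ = {(i,j) : 0 ≤ i < j ≤ d−1 and g_{i,j}(α_i − α_j) < 0}. -/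

import Mathlib

open MeasureTheory Filter Set ContinuousLinearMap
open scoped RealInnerProductSpace

/-- The rank-one operator `x ↦ ⟪u, x⟫ • v`, i.e. `u*(·) v`. -/
noncomputable def rankOne {𝓗 : Type*} [NormedAddCommGroup 𝓗] [InnerProductSpace ℝ 𝓗]
    (u v : 𝓗) : 𝓗 →L[ℝ] 𝓗 :=
  (innerSL ℝ u).smulRight v

/-- The symmetric family `E_{i,j}` in finite dimension. -/
noncomputable def EsymF {𝓗 : Type*} [NormedAddCommGroup 𝓗] [InnerProductSpace ℝ 𝓗]
    {d : ℕ} (e : OrthonormalBasis (Fin d) ℝ 𝓗) (i j : Fin d) : 𝓗 →L[ℝ] 𝓗 :=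
  if i = j then rankOne (e i) (e i)
  else (Real.sqrt 2)⁻¹ • (rankOne (e j) (e i) + rankOne (e i) (e j))

/-- The skew-symmetric family `E±_{i,j}` in finite dimension. -/
noncomputable def EskewF {𝓗 : Type*} [NormedAddCommGroup 𝓗] [InnerProductSpace ℝ 𝓗]
    {d : ℕ} (e : OrthonormalBasis (Fin d) ℝ 𝓗) (i j : Fin d) : 𝓗 →L[ℝ] 𝓗 :=
  (Real.sqrt 2)⁻¹ • (rankOne (e j) (e i) - rankOne (e i) (e j))

/-- If `f → 0` at infinity and `|f'| = O(e^{-ct})` with `c > 0`, then `f = O(e^{-ct})`. -/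
theorem isBigO_exp_of_deriv_isBigO_exp {f f' : ℝ → ℝ} {c : ℝ} (hc : 0 < c)
    (hf : ∀ᶠ t in atTop, HasDerivAt f (f' t) t) (hlim : Tendsto f atTop (nhds 0))
    (hf' : f' =O[atTop] fun t => Real.exp (-c * t)) :
    f =O[atTop] fun t => Real.exp (-c * t) := by
  have key : ∀ {f f' : ℝ → ℝ}, (∀ᶠ t in atTop, HasDerivAt f (f' t) t) →
      Tendsto f atTop (nhds 0) → ∀ K : ℝ, (∀ᶠ t in atTop, |f' t| ≤ K * Real.exp (-c * t)) →
      ∀ᶠ t in atTop, f t ≤ K / c * Real.exp (-c * t) := by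
    intro f f' hf hlim K hK
    obtain ⟨T, hT⟩ := eventually_atTop.1 (hf.and hK)
    have hd : ∀ t ≥ T, HasDerivAt (fun t => f t - K / c * Real.exp (-c * t))
        (f' t + K * Real.exp (-c * t)) t := by
      intro t ht
      have h1 : HasDerivAt (fun t : ℝ => Real.exp (-c * t)) (Real.exp (-c * t) * (-c * 1)) t :=
        ((hasDerivAt_id t).const_mul (-c)).exp
      refine ((hT t ht).1.sub (h1.const_mul (K / c))).congr_deriv ?_
      field_simp
      ring
    have hmono : MonotoneOn (fun t => f t - K / c * Real.exp (-c * t)) (Ici T) := by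
      refine monotoneOn_of_deriv_nonneg (convex_Ici T)
        (fun t ht => (hd t ht).continuousAt.continuousWithinAt) ?_ ?_
      · intro t ht
        exact (hd t (interior_subset ht)).differentiableAt.differentiableWithinAt
      · intro t ht
        have ht := interior_subset ht
        rw [(hd t ht).deriv]
        have := (abs_le.1 (hT t ht).2).1
        linarith
    have hlim' : Tendsto (fun t => f t - K / c * Real.exp (-c * t)) atTop (nhds 0) := by
      have h2 : Tendsto (fun t : ℝ => Real.exp (-c * t)) atTop (nhds 0) := by
        refine Real.tendsto_exp_atBot.comp ?_
        exact tendsto_id.const_mul_atTop_of_neg (by linarith)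
      simpa using hlim.sub (h2.const_mul (K / c))
    filter_upwards [eventually_ge_atTop T] with t ht
    have : f t - K / c * Real.exp (-c * t) ≤ 0 := by
      refine ge_of_tendsto hlim' ?_
      filter_upwards [eventually_ge_atTop t] with s hs
      exact hmono ht (le_trans ht hs) hs
    linarith
  obtain ⟨K, hK⟩ := hf'.bound
  simp only [Real.norm_eq_abs, Real.abs_exp] at hK
  have h1 := key hf hlim K hK
  have h2 := key (f := fun t => -f t) (f' := fun t => -f' t) (hf.mono fun t h => h.neg)
    (by simpa using hlim.neg) K (by simpa using hK)
  refine Asymptotics.IsBigO.of_bound (K / c) ?_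
  filter_upwards [h1, h2] with t h1 h2
  rw [Real.norm_eq_abs, Real.norm_eq_abs, Real.abs_exp, abs_le]
  constructor <;> linarith

/-- Differential form of Gronwall's inequality near infinity. -/
theorem exists_le_mul_exp_of_deriv_le {u u' A a : ℝ → ℝ}
    (hu : ∀ᶠ t in atTop, HasDerivAt u (u' t) t) (hA : ∀ᶠ t in atTop, HasDerivAt A (a t) t)
    (h : ∀ᶠ t in atTop, u' t ≤ a t * u t) :
    ∃ C, ∀ᶠ t in atTop, u t ≤ C * Real.exp (A t) := by
  obtain ⟨T, hT⟩ := eventually_atTop.1 (hu.and (hA.and h))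
  have hd : ∀ t ≥ T, HasDerivAt (fun t => u t * Real.exp (-A t))
      (u' t * Real.exp (-A t) + u t * (Real.exp (-A t) * (-a t))) t := fun t ht =>
    (hT t ht).1.mul (hT t ht).2.1.neg.exp
  have hanti : AntitoneOn (fun t => u t * Real.exp (-A t)) (Ici T) := by
    refine antitoneOn_of_deriv_nonpos (convex_Ici T)
      (fun t ht => (hd t ht).continuousAt.continuousWithinAt) ?_ ?_
    · intro t ht
      exact (hd t (interior_subset ht)).differentiableAt.differentiableWithinAt
    · intro t ht
      have ht := interior_subset ht
      rw [(hd t ht).deriv]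
      have := mul_le_mul_of_nonneg_right (hT t ht).2.2 (Real.exp_pos (-A t)).le
      linarith
  refine ⟨u T * Real.exp (-A T), ?_⟩
  filter_upwards [eventually_ge_atTop T] with t ht
  have h1 := mul_le_mul_of_nonneg_right (hanti self_mem_Ici ht ht) (Real.exp_pos (A t)).le
  simp only [mul_assoc, ← Real.exp_add, neg_add_cancel, Real.exp_zero, mul_one] at h1
  rw [mul_assoc, ← Real.exp_add]
  exact h1

/-- A decaying solution of an asymptotically autonomous hyperbolic diagonal system is eventually
controlled by its stable components. -/
theorem exists_stable_energy {ι : Type*} [Fintype ι] {x r : ι → ℝ → ℝ} {lam : ι → ℝ}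
    {δ : ℝ → ℝ} {γ : ℝ} (hγ : 0 < γ) (hlam : ∀ p, lam p ≠ 0)
    (hneg : ∀ p, lam p < 0 → lam p ≤ -γ)
    (hx : ∀ p, ∀ᶠ t in atTop, HasDerivAt (x p) (lam p * x p t + r p t) t)
    (hr : ∀ p, ∀ᶠ t in atTop, |r p t| ≤ δ t * ∑ q, |x q t|)
    (hx0 : ∀ p, Tendsto (x p) atTop (nhds 0)) (hδ : Tendsto δ atTop (nhds 0))
    (hδ0 : ∀ t, 0 ≤ δ t) :
    ∃ (u u' : ℝ → ℝ) (k : ℝ), 0 ≤ k ∧ (∀ᶠ t in atTop, HasDerivAt u (u' t) t) ∧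
      (∀ᶠ t in atTop, u' t ≤ (-(2 * γ) + k * δ t) * u t) ∧
      ∀ p, ∀ᶠ t in atTop, x p t ^ 2 ≤ 2 * u t := by
  classical
  obtain ⟨μ, hμ, hpos⟩ : ∃ μ > 0, ∀ p, 0 < lam p → μ ≤ lam p := by
    have : ∀ᶠ μ in nhdsWithin (0 : ℝ) (Ioi 0), ∀ p, 0 < lam p → μ ≤ lam p := by
      refine eventually_all.2 fun p => ?_
      by_cases hp : 0 < lam p
      · filter_upwards [mem_nhdsWithin_of_mem_nhds (Iio_mem_nhds hp)] with μ h _ using h.le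
      · exact Eventually.of_forall fun _ h => absurd h hp
    obtain ⟨μ, h1, h2⟩ := (this.and self_mem_nhdsWithin).exists
    exact ⟨μ, h2, h1⟩
  let S : Finset ι := Finset.univ.filter fun p => lam p < 0
  let U : Finset ι := Finset.univ.filter fun p => ¬ lam p < 0
  let n : ℝ := Fintype.card ι
  let E : Finset ι → ℝ → ℝ := fun s t => ∑ p ∈ s, x p t ^ 2
  let E' : Finset ι → ℝ → ℝ := fun s t => ∑ p ∈ s, 2 * x p t * (lam p * x p t + r p t)
  have hE : ∀ s, ∀ᶠ t in atTop, HasDerivAt (E s) (E' s t) t := by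
    intro s
    filter_upwards [eventually_all.2 hx] with t ht
    refine HasDerivAt.fun_sum fun p _ => ?_
    exact ((ht p).pow 2).congr_deriv (by simp)
  have hE0 : ∀ s t, 0 ≤ E s t := fun s t => Finset.sum_nonneg fun p _ => sq_nonneg _
  have hElim : ∀ s, Tendsto (E s) atTop (nhds 0) := by
    intro s
    have : Tendsto (E s) atTop (nhds (∑ p ∈ s, (0 : ℝ) ^ 2)) :=
      tendsto_finsetSum _ fun p _ => (hx0 p).pow 2
    simpa using this
  have hsplit : ∀ t, ∑ p, x p t ^ 2 = E S t + E U t := fun t =>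
    (Finset.sum_filter_add_sum_filter_not _ _ _).symm
  have herr : ∀ᶠ t in atTop, ∀ s : Finset ι,
      |∑ p ∈ s, 2 * x p t * r p t| ≤ 2 * n * δ t * (E S t + E U t) := by
    filter_upwards [eventually_all.2 hr] with t ht s
    have hcs : (∑ q, |x q t|) ^ 2 ≤ n * ∑ q, x q t ^ 2 := by
      simpa [n] using sq_sum_le_card_mul_sum_sq (s := Finset.univ) (f := fun q => |x q t|)
    calc |∑ p ∈ s, 2 * x p t * r p t|
        ≤ ∑ p ∈ s, |2 * x p t * r p t| := Finset.abs_sum_le_sum_abs _ _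
      _ ≤ ∑ p, |2 * x p t * r p t| :=
          Finset.sum_le_sum_of_subset_of_nonneg (Finset.subset_univ _) fun _ _ _ => abs_nonneg _
      _ ≤ ∑ p, 2 * (|x p t| * (δ t * ∑ q, |x q t|)) := by
          refine Finset.sum_le_sum fun p _ => ?_
          rw [abs_mul, abs_mul, abs_two, mul_assoc]
          have := ht p
          gcongr
      _ = 2 * δ t * (∑ q, |x q t|) ^ 2 := by
          rw [← Finset.mul_sum, ← Finset.sum_mul]
          ring
      _ ≤ 2 * δ t * (n * ∑ q, x q t ^ 2) := by
          have := hδ0 t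
          gcongr
      _ = 2 * n * δ t * (E S t + E U t) := by
          rw [hsplit]
          ring
  have hE'eq : ∀ s t, E' s t = ∑ p ∈ s, 2 * (lam p * x p t ^ 2) + ∑ p ∈ s, 2 * x p t * r p t := by
    intro s t
    rw [← Finset.sum_add_distrib]
    exact Finset.sum_congr rfl fun p _ => by ring
  have hS : ∀ᶠ t in atTop, E' S t ≤ -(2 * γ) * E S t + 2 * n * δ t * (E S t + E U t) := by
    filter_upwards [herr] with t ht
    rw [hE'eq]
    refine add_le_add ?_ ((le_abs_self _).trans (ht S))
    rw [Finset.mul_sum]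
    refine Finset.sum_le_sum fun p hp => ?_
    have h1 := hneg p (Finset.mem_filter.1 hp).2
    nlinarith [sq_nonneg (x p t)]
  have hU : ∀ᶠ t in atTop, 2 * μ * E U t - 2 * n * δ t * (E S t + E U t) ≤ E' U t := by
    filter_upwards [herr] with t ht
    rw [hE'eq, sub_eq_add_neg]
    refine add_le_add ?_ (abs_le.1 (ht U)).1
    rw [Finset.mul_sum]
    refine Finset.sum_le_sum fun p hp => ?_
    have h1 := hpos p (lt_of_le_of_ne (not_lt.1 (Finset.mem_filter.1 hp).2) (hlam p).symm)
    nlinarith [sq_nonneg (x p t)]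
  have hn : (0 : ℝ) ≤ n := Nat.cast_nonneg _
  have hsmall : ∀ᶠ t in atTop, 4 * n * δ t ≤ 2 * μ ∧ 4 * n * δ t ≤ 2 * γ := by
    have h1 : Tendsto (fun t => 4 * n * δ t) atTop (nhds 0) := by
      simpa using hδ.const_mul (4 * n)
    exact (h1.eventually_le_const (by linarith)).and (h1.eventually_le_const (by linarith))
  have hUS : ∀ᶠ t in atTop, E U t ≤ E S t := by
    obtain ⟨T, hT⟩ := eventually_atTop.1 ((hE S).and ((hE U).and (hS.and (hU.and hsmall))))
    have hd : ∀ t ≥ T, HasDerivAt (fun t => E U t - E S t) (E' U t - E' S t) t := fun t ht =>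
      (hT t ht).2.1.sub (hT t ht).1
    have hmono : MonotoneOn (fun t => E U t - E S t) (Ici T) := by
      refine monotoneOn_of_deriv_nonneg (convex_Ici T)
        (fun t ht => (hd t ht).continuousAt.continuousWithinAt) ?_ ?_
      · intro t ht
        exact (hd t (interior_subset ht)).differentiableAt.differentiableWithinAt
      · intro t ht
        have ht := interior_subset ht
        rw [(hd t ht).deriv]
        obtain ⟨-, -, h1, h2, h3, h4⟩ := hT t ht
        have h5 := mul_le_mul_of_nonneg_right h3 (hE0 U t)
        have h6 := mul_le_mul_of_nonneg_right h4 (hE0 S t)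
        linarith
    have hlim : Tendsto (fun t => E U t - E S t) atTop (nhds 0) := by
      simpa using (hElim U).sub (hElim S)
    filter_upwards [eventually_ge_atTop T] with t ht
    have : E U t - E S t ≤ 0 := by
      refine ge_of_tendsto hlim ?_
      filter_upwards [eventually_ge_atTop t] with s hs
      exact hmono ht (le_trans ht hs) hs
    linarith
  refine ⟨E S, E' S, 4 * n, by positivity, hE S, ?_, fun p => ?_⟩
  · filter_upwards [hS, hUS] with t h1 h2
    have h3 := mul_le_mul_of_nonneg_left h2 (mul_nonneg hn (hδ0 t))
    linarith
  · filter_upwards [hUS] with t h1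
    have : x p t ^ 2 ≤ ∑ p, x p t ^ 2 :=
      Finset.single_le_sum (f := fun p => x p t ^ 2) (fun _ _ => sq_nonneg _) (Finset.mem_univ p)
    rw [hsplit] at this
    linarith

/-- If the square of `f` is eventually at most a multiple of `e^{-2ct}`, then
`f = O(e^{-ct})`. -/
theorem isBigO_exp_of_sq_le {f : ℝ → ℝ} {c C : ℝ}
    (h : ∀ᶠ t in atTop, f t ^ 2 ≤ C * Real.exp (-(2 * c) * t)) :
    f =O[atTop] fun t => Real.exp (-c * t) := by
  refine Asymptotics.IsBigO.of_pow (n := 2) two_ne_zero (Asymptotics.IsBigO.of_bound C ?_)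
  filter_upwards [h] with t ht
  have h1 : Real.exp (-c * t) ^ 2 = Real.exp (-(2 * c) * t) := by
    rw [← Real.exp_nat_mul]
    congr 1
    push_cast
    ring
  rw [Pi.pow_apply, Pi.pow_apply, norm_pow, norm_pow, Real.norm_eq_abs, Real.norm_eq_abs, sq_abs,
    sq_abs, h1]
  exact ht

/-- Exponential decay at (at least) half of the optimal rate. -/
theorem isBigO_exp_half_of_hyperbolic {ι : Type*} [Fintype ι] {x r : ι → ℝ → ℝ} {lam : ι → ℝ}
    {δ : ℝ → ℝ} {γ : ℝ} (hγ : 0 < γ) (hlam : ∀ p, lam p ≠ 0)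
    (hneg : ∀ p, lam p < 0 → lam p ≤ -γ)
    (hx : ∀ p, ∀ᶠ t in atTop, HasDerivAt (x p) (lam p * x p t + r p t) t)
    (hr : ∀ p, ∀ᶠ t in atTop, |r p t| ≤ δ t * ∑ q, |x q t|)
    (hx0 : ∀ p, Tendsto (x p) atTop (nhds 0)) (hδ : Tendsto δ atTop (nhds 0))
    (hδ0 : ∀ t, 0 ≤ δ t) (p : ι) :
    x p =O[atTop] fun t => Real.exp (-(γ / 2) * t) := by
  obtain ⟨u, u', k, hk, hu, hu', hxu⟩ := exists_stable_energy hγ hlam hneg hx hr hx0 hδ hδ0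
  have hsmall : ∀ᶠ t in atTop, k * δ t ≤ γ := by
    have h1 : Tendsto (fun t => k * δ t) atTop (nhds 0) := by simpa using hδ.const_mul k
    exact h1.eventually_le_const hγ
  obtain ⟨C, hC⟩ := exists_le_mul_exp_of_deriv_le (A := fun t => -γ * t) (a := fun _ => -γ) hu
    (Eventually.of_forall fun t => by simpa using (hasDerivAt_id t).const_mul (-γ)) (by
      filter_upwards [hu', hsmall, hxu p] with t h1 h2 h3
      refine h1.trans (mul_le_mul_of_nonneg_right (by linarith) ?_)
      nlinarith [sq_nonneg (x p t)])
  refine isBigO_exp_of_sq_le (C := 2 * C) ?_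
  filter_upwards [hC, hxu p] with t h1 h2
  rw [show -(2 * (γ / 2)) * t = -γ * t by ring]
  linarith

/-- Exponential decay at the optimal rate when the perturbation decays exponentially. -/
theorem isBigO_exp_of_hyperbolic {ι : Type*} [Fintype ι] {x r : ι → ℝ → ℝ} {lam : ι → ℝ}
    {δ : ℝ → ℝ} {γ c : ℝ} (hγ : 0 < γ) (hlam : ∀ p, lam p ≠ 0)
    (hneg : ∀ p, lam p < 0 → lam p ≤ -γ)
    (hx : ∀ p, ∀ᶠ t in atTop, HasDerivAt (x p) (lam p * x p t + r p t) t)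
    (hr : ∀ p, ∀ᶠ t in atTop, |r p t| ≤ δ t * ∑ q, |x q t|)
    (hx0 : ∀ p, Tendsto (x p) atTop (nhds 0)) (hδ : Tendsto δ atTop (nhds 0))
    (hδ0 : ∀ t, 0 ≤ δ t) (hc : 0 < c) (hδc : δ =O[atTop] fun t => Real.exp (-c * t)) (p : ι) :
    x p =O[atTop] fun t => Real.exp (-γ * t) := by
  obtain ⟨u, u', k, hk, hu, hu', hxu⟩ := exists_stable_energy hγ hlam hneg hx hr hx0 hδ hδ0
  obtain ⟨K, hK0, hK⟩ := hδc.exists_pos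
  have hK := hK.bound
  obtain ⟨C, hC⟩ := exists_le_mul_exp_of_deriv_le
    (A := fun t => -(2 * γ) * t - k * K / c * Real.exp (-c * t))
    (a := fun t => -(2 * γ) + k * K * Real.exp (-c * t)) hu
    (Eventually.of_forall fun t => by
      have h1 : HasDerivAt (fun t : ℝ => Real.exp (-c * t)) (Real.exp (-c * t) * (-c * 1)) t :=
        ((hasDerivAt_id t).const_mul (-c)).exp
      refine (((hasDerivAt_id t).const_mul (-(2 * γ))).sub
        (h1.const_mul (k * K / c))).congr_deriv ?_
      field_simp
      ring) (by
      filter_upwards [hu', hK, hxu p] with t h1 h2 h3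
      refine h1.trans (mul_le_mul_of_nonneg_right ?_ (by nlinarith [sq_nonneg (x p t)]))
      rw [Real.norm_eq_abs, Real.norm_eq_abs, Real.abs_exp, abs_of_nonneg (hδ0 t)] at h2
      nlinarith)
  refine isBigO_exp_of_sq_le (C := 2 * |C|) ?_
  filter_upwards [hC, hxu p] with t h1 h2
  have h3 : Real.exp (-(2 * γ) * t - k * K / c * Real.exp (-c * t)) ≤ Real.exp (-(2 * γ) * t) :=
    Real.exp_le_exp.2 (sub_le_self _ (by positivity))
  have h4 := mul_le_mul (le_abs_self C) h3 (Real.exp_pos _).le (abs_nonneg C)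
  linarith

section Operators

variable {𝓗 : Type*} [NormedAddCommGroup 𝓗] [InnerProductSpace ℝ 𝓗] {d : ℕ}

@[simp]
theorem rankOne_apply (u v x : 𝓗) : rankOne u v x = ⟪u, x⟫ • v := by
  simp [rankOne]

theorem eq_sum_rankOne (e : OrthonormalBasis (Fin d) ℝ 𝓗) (A : 𝓗 →L[ℝ] 𝓗) :
    A = ∑ i, ∑ j, ⟪e i, A (e j)⟫ • rankOne (e j) (e i) := by
  ext x
  simp only [_root_.sum_apply, _root_.smul_apply, rankOne_apply]
  conv_lhs => rw [← e.sum_repr' x, map_sum]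
  rw [Finset.sum_comm]
  refine Finset.sum_congr rfl fun j _ => ?_
  rw [map_smul]
  conv_lhs => rw [← e.sum_repr' (A (e j)), Finset.smul_sum]
  exact Finset.sum_congr rfl fun i _ => smul_comm _ _ _

theorem norm_le_sum_abs_inner (e : OrthonormalBasis (Fin d) ℝ 𝓗) (A : 𝓗 →L[ℝ] 𝓗) :
    ‖A‖ ≤ ∑ i, ∑ j, |⟪e i, A (e j)⟫| := by
  conv_lhs => rw [eq_sum_rankOne e A]
  refine (norm_sum_le _ _).trans (Finset.sum_le_sum fun i _ => ?_)
  refine (norm_sum_le _ _).trans (Finset.sum_le_sum fun j _ => ?_)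
  rw [norm_smul, rankOne, norm_smulRight_apply, innerSL_apply_norm]
  simp

/-- A diagonalizable map acts on the matrix entries of a symmetric operator by multiplication with
its matrix-eigenvalue. -/
theorem inner_diagonalizable_apply (e : OrthonormalBasis (Fin d) ℝ 𝓗)
    (G : (𝓗 →L[ℝ] 𝓗) →ₗ[ℝ] (𝓗 →L[ℝ] 𝓗)) {g : Fin d → Fin d → ℝ} (hg : ∀ i j, g j i = -g i j)
    (hG : ∀ i j, G (EsymF e i j) = g i j • EskewF e i j) {A : 𝓗 →L[ℝ] 𝓗}
    (hA : ∀ x y, ⟪A x, y⟫ = ⟪x, A y⟫) (k l : Fin d) :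
    ⟪e k, G A (e l)⟫ = g k l * ⟪e k, A (e l)⟫ := by
  classical
  have hsymm : ∀ i j, ⟪e j, A (e i)⟫ = ⟪e i, A (e j)⟫ := fun i j => by
    rw [← hA, real_inner_comm]
  have hunit : ∀ i j, G (rankOne (e j) (e i) + rankOne (e i) (e j)) =
      g i j • (rankOne (e j) (e i) - rankOne (e i) (e j)) := by
    intro i j
    have h2 : (Real.sqrt 2) ≠ 0 := by positivity
    have := hG i j
    by_cases hij : i = j
    · subst hij
      have h0 : g i i = 0 := by linarith [hg i i]
      rw [EsymF, if_pos rfl, h0, zero_smul] at this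
      simp [this]
    · rw [EsymF, if_neg hij, EskewF, map_smul, smul_comm] at this
      exact smul_right_injective _ (inv_ne_zero h2) this
  have hdecomp : A = ∑ i, ∑ j, (⟪e i, A (e j)⟫ / 2) •
      (rankOne (e j) (e i) + rankOne (e i) (e j)) := by
    have h1 : A = ∑ i, ∑ j, ⟪e i, A (e j)⟫ • rankOne (e i) (e j) := by
      conv_lhs => rw [eq_sum_rankOne e A, Finset.sum_comm]
      simp only [hsymm]
    simp only [smul_add, Finset.sum_add_distrib, div_eq_inv_mul, mul_smul, ← Finset.smul_sum]
    rw [← h1, ← eq_sum_rankOne e A, ← add_smul]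
    norm_num
  have hGA : G A = ∑ i, ∑ j, (⟪e i, A (e j)⟫ / 2 * g i j) •
      (rankOne (e j) (e i) - rankOne (e i) (e j)) := by
    conv_lhs => rw [hdecomp]
    simp only [map_sum, map_smul, hunit, smul_smul]
  rw [hGA]
  simp only [_root_.sum_apply, _root_.smul_apply,
    _root_.sub_apply, rankOne_apply, inner_sum, inner_smul_right, inner_sub_right,
    orthonormal_iff_ite.1 e.orthonormal]
  simp [mul_sub, Finset.sum_sub_distrib, hsymm k l, hg k l]
  ring

theorem trace_pow_of_eigenbasis (e : OrthonormalBasis (Fin d) ℝ 𝓗) {A : 𝓗 →L[ℝ] 𝓗}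
    {α : Fin d → ℝ} (hA : ∀ i, A (e i) = α i • e i) (n : ℕ) :
    LinearMap.trace ℝ 𝓗 ((A ^ n : 𝓗 →L[ℝ] 𝓗) : 𝓗 →ₗ[ℝ] 𝓗) = ∑ i, α i ^ n := by
  have hpow : ∀ i, (A ^ n) (e i) = α i ^ n • e i := by
    intro i
    induction n with
    | zero => simp
    | succ n ih =>
      rw [pow_succ, mul_apply_eq_comp, hA, map_smul, ih, smul_smul, pow_succ, mul_comm]
  rw [LinearMap.trace_eq_sum_inner _ e]
  refine Finset.sum_congr rfl fun i _ => ?_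
  rw [ContinuousLinearMap.coe_coe, hpow, inner_smul_right, real_inner_self_eq_norm_sq,
    e.norm_eq_one]
  simp

end Operators

section Flow

variable {𝓗 : Type*} [NormedAddCommGroup 𝓗] [InnerProductSpace ℝ 𝓗] [FiniteDimensional ℝ 𝓗]

/-- The flow of `H' = [H, G(H)]` preserves symmetry when `G` maps symmetric operators to
skew-symmetric ones. -/
theorem symmetric_of_bracket_flow (G : (𝓗 →L[ℝ] 𝓗) →ₗ[ℝ] (𝓗 →L[ℝ] 𝓗))
    (hG : ∀ A : 𝓗 →L[ℝ] 𝓗, (∀ x y, ⟪A x, y⟫ = ⟪x, A y⟫) → ∀ x y, ⟪G A x, y⟫ = -⟪x, G A y⟫)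
    {H : ℝ → 𝓗 →L[ℝ] 𝓗} (h0 : ∀ x y, ⟪H 0 x, y⟫ = ⟪x, H 0 y⟫)
    (hH : ∀ t ∈ Ici (0 : ℝ), HasDerivWithinAt H (H t * G (H t) - G (H t) * H t) (Ici 0) t)
    {t : ℝ} (ht : 0 ≤ t) (x y : 𝓗) : ⟪H t x, y⟫ = ⟪x, H t y⟫ := by
  have : CompleteSpace 𝓗 := FiniteDimensional.complete ℝ 𝓗
  have hsa : ∀ A : 𝓗 →L[ℝ] 𝓗, star A = A ↔ ∀ x y, ⟪A x, y⟫ = ⟪x, A y⟫ := fun A => by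
    rw [eq_comm, star_eq_adjoint, eq_adjoint_iff]
  have hsk : ∀ A : 𝓗 →L[ℝ] 𝓗, star A = A → star (G A) = -G A := fun A hA => by
    rw [eq_comm, star_eq_adjoint, eq_adjoint_iff]
    intro x y
    rw [_root_.neg_apply, inner_neg_left, hG A ((hsa A).1 hA), neg_neg]
  have hnorm : ∀ A : 𝓗 →L[ℝ] 𝓗, ‖star A‖ = ‖A‖ := fun A => by
    rw [star_eq_adjoint, LinearIsometryEquiv.norm_map]
  let F : (𝓗 →L[ℝ] 𝓗) → (𝓗 →L[ℝ] 𝓗) := fun A => A * G A - G A * A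
  have hF : ∀ A, star A = A → star (F A) = F A := fun A hA => by
    simp only [F, star_sub, star_mul, hA, hsk A hA]
    noncomm_ring
  let G' : (𝓗 →L[ℝ] 𝓗) →L[ℝ] (𝓗 →L[ℝ] 𝓗) := G.toContinuousLinearMap
  have hG' : ∀ A, ‖G A‖ ≤ ‖G'‖ * ‖A‖ := fun A => G'.le_opNorm A
  have hcont : ContinuousOn H (Icc 0 t) := fun s hs =>
    ((hH s hs.1).continuousWithinAt).mono Icc_subset_Ici_self
  obtain ⟨M, hM⟩ := isCompact_Icc.exists_bound_of_continuousOn hcont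
  have hlip : ∀ A B : 𝓗 →L[ℝ] 𝓗, ‖A‖ ≤ M → ‖B‖ ≤ M → ‖F A - F B‖ ≤ 4 * M * ‖G'‖ * ‖A - B‖ := by
    intro A B hA hB
    have h1 : F A - F B = ((A - B) * G A + B * G (A - B)) - (G (A - B) * A + G B * (A - B)) := by
      simp only [F, map_sub]
      noncomm_ring
    have hM0 : 0 ≤ M := (norm_nonneg A).trans hA
    have hGA : ‖G A‖ ≤ ‖G'‖ * M := (hG' A).trans (by gcongr)
    have hGB : ‖G B‖ ≤ ‖G'‖ * M := (hG' B).trans (by gcongr)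
    have hGd := hG' (A - B)
    rw [h1]
    calc _ ≤ (‖A - B‖ * ‖G A‖ + ‖B‖ * ‖G (A - B)‖) + (‖G (A - B)‖ * ‖A‖ + ‖G B‖ * ‖A - B‖) := by
          refine (norm_sub_le _ _).trans (add_le_add ?_ ?_) <;>
          exact (norm_add_le _ _).trans (add_le_add (norm_mul_le _ _) (norm_mul_le _ _))
      _ ≤ (‖A - B‖ * (‖G'‖ * M) + M * (‖G'‖ * ‖A - B‖)) +
          ((‖G'‖ * ‖A - B‖) * M + (‖G'‖ * M) * ‖A - B‖) := by gcongr
      _ = _ := by ring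
  let W : ℝ → 𝓗 →L[ℝ] 𝓗 := fun s => H s - star (H s)
  have hW : ∀ s ∈ Ici (0 : ℝ), HasDerivWithinAt W (F (H s) - star (F (H s))) (Ici 0) s :=
    fun s hs => (hH s hs).sub (hH s hs).star
  have hbound : ∀ s ∈ Ico 0 t, ‖F (H s) - star (F (H s))‖ ≤ 4 * M * ‖G'‖ * ‖W s‖ + 0 := by
    intro s hs
    let S : 𝓗 →L[ℝ] 𝓗 := (2⁻¹ : ℝ) • (H s + star (H s))
    have hHM := hM s (Ico_subset_Icc_self hs)
    have hS : star S = S := by simp [S, add_comm]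
    have hSM : ‖S‖ ≤ M := by
      rw [norm_smul]
      have := norm_add_le (H s) (star (H s))
      rw [hnorm] at this
      norm_num
      linarith
    have hHS : H s - S = (2⁻¹ : ℝ) • W s := by
      simp only [S, W]
      module
    have h1 : F (H s) - star (F (H s)) = (F (H s) - F S) - star (F (H s) - F S) := by
      rw [star_sub (F (H s)) (F S), hF S hS]
      abel
    have h2 := hlip _ _ hHM hSM
    rw [hHS, norm_smul] at h2
    rw [h1, add_zero]
    refine (norm_sub_le _ _).trans ?_
    rw [hnorm]
    norm_num at h2
    linarith
  have hWt := norm_le_gronwallBound_of_norm_deriv_right_le (δ := 0) (f := W)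
    (fun s hs => ((hW s hs.1).continuousWithinAt).mono Icc_subset_Ici_self)
    (fun s hs => (hW s hs.1).mono (Ici_subset_Ici.2 hs.1))
    (by simp [W, (hsa _).2 h0]) hbound t (right_mem_Icc.2 ht)
  rw [gronwallBound_ε0_δ0] at hWt
  exact (hsa _).1 (sub_eq_zero.1 (norm_le_zero_iff.1 hWt)).symm x y

/-- The flow of `H' = [H, G(H)]` preserves the traces of powers. -/
theorem trace_pow_eq_of_bracket_flow {H B : ℝ → 𝓗 →L[ℝ] 𝓗}
    (hH : ∀ t ∈ Ici (0 : ℝ), HasDerivWithinAt H (H t * B t - B t * H t) (Ici 0) t)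
    (n : ℕ) {t : ℝ} (ht : 0 ≤ t) :
    LinearMap.trace ℝ 𝓗 ((H t ^ n : 𝓗 →L[ℝ] 𝓗) : 𝓗 →ₗ[ℝ] 𝓗) =
      LinearMap.trace ℝ 𝓗 ((H 0 ^ n : 𝓗 →L[ℝ] 𝓗) : 𝓗 →ₗ[ℝ] 𝓗) := by
  have hpow : ∀ s ∈ Ici (0 : ℝ), HasDerivWithinAt (fun s => H s ^ n)
      (H s ^ n * B s - B s * H s ^ n) (Ici 0) s := by
    intro s hs
    induction n with
    | zero => simpa using hasDerivWithinAt_const s (Ici 0) (1 : 𝓗 →L[ℝ] 𝓗)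
    | succ n ih =>
      simp only [pow_succ]
      refine (ih.mul (hH s hs)).congr_deriv ?_
      noncomm_ring
  let τ : (𝓗 →L[ℝ] 𝓗) →L[ℝ] ℝ :=
    ((LinearMap.trace ℝ 𝓗).comp (coeLM ℝ)).toContinuousLinearMap
  have hτ : ∀ A B : 𝓗 →L[ℝ] 𝓗, τ (A * B - B * A) = 0 := fun A B => by
    have := LinearMap.trace_mul_comm ℝ (A : 𝓗 →ₗ[ℝ] 𝓗) (B : 𝓗 →ₗ[ℝ] 𝓗)
    rw [map_sub, sub_eq_zero]
    exact this
  have hderiv : ∀ s ∈ Ici (0 : ℝ), HasDerivWithinAt (fun s => τ (H s ^ n)) 0 (Ici 0) s := by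
    intro s hs
    have := τ.hasFDerivAt.comp_hasDerivWithinAt s (hpow s hs)
    rwa [hτ] at this
  exact constant_of_has_deriv_right_zero
    (fun s hs => ((hderiv s hs.1).continuousWithinAt).mono Icc_subset_Ici_self)
    (fun s hs => (hderiv s hs.1).mono (Ici_subset_Ici.2 hs.1)) t (right_mem_Icc.2 ht)

end Flow

/-- Two finite families with the same power sums: if one is injective, so is the other. -/
theorem injective_of_sum_pow_eq {ι : Type*} [Fintype ι] {α β : ι → ℝ}
    (hβ : Function.Injective β) (h : ∀ n : ℕ, ∑ i, α i ^ n = ∑ i, β i ^ n) :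
    Function.Injective α := by
  classical
  have hpoly : ∀ q : Polynomial ℝ, ∑ i, q.eval (α i) = ∑ i, q.eval (β i) := by
    intro q
    simp only [Polynomial.eval_eq_sum_range]
    rw [Finset.sum_comm, Finset.sum_comm (s := Finset.univ)]
    exact Finset.sum_congr rfl fun n _ => by rw [← Finset.mul_sum, ← Finset.mul_sum, h]
  intro a b hab
  by_contra hne
  let s : Finset ℝ := Finset.univ.image α ∪ Finset.univ.image β
  let q : Polynomial ℝ := Lagrange.basis s id (α a)
  have hq : ∀ z ∈ s, q.eval z = if z = α a then 1 else 0 := by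
    intro z hz
    split_ifs with hza
    · subst hza
      exact Lagrange.eval_basis_self (Set.injOn_id _) hz
    · exact Lagrange.eval_basis_of_ne (v := id) (Ne.symm hza) hz
  have h1 := hpoly q
  simp only [hq _ (Finset.mem_union_left _ (Finset.mem_image_of_mem α (Finset.mem_univ _))),
    hq _ (Finset.mem_union_right _ (Finset.mem_image_of_mem β (Finset.mem_univ _))),
    Finset.sum_boole] at h1
  have h2 : 1 < (Finset.univ.filter fun i => α i = α a).card :=
    Finset.one_lt_card.2 ⟨a, by simp, b, by simp [hab], hne⟩
  have h3 : (Finset.univ.filter fun i => β i = α a).card ≤ 1 :=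
    Finset.card_le_one.2 fun i hi j hj => hβ (by simp_all)
  have h4 := Nat.cast_injective (R := ℝ) h1
  omega

/-- Exponential convergence, at the optimal rate, of the matrix entries of a convergent solution of
`H' = [H, G(H)]` towards a diagonal matrix with pairwise distinct entries. -/
theorem isBigO_exp_entry {ι : Type*} [Fintype ι] [DecidableEq ι] {h : ι → ι → ℝ → ℝ}
    {g : ι → ι → ℝ} {α : ι → ℝ} {γ : ℝ} (hγ : 0 < γ) (hg : ∀ i j, g j i = -g i j)
    (hg0 : ∀ i j, i ≠ j → g i j ≠ 0) (hα : Function.Injective α)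
    (hneg : ∀ i j, g i j * (α i - α j) < 0 → g i j * (α i - α j) ≤ -γ)
    (hh : ∀ i j, ∀ᶠ t in atTop,
      HasDerivAt (h i j) (∑ k, (g k j - g i k) * (h i k t * h k j t)) t)
    (hlim : ∀ i j, Tendsto (h i j) atTop (nhds (if i = j then α i else 0))) (i j : ι) :
    (fun t => h i j t - if i = j then α i else 0) =O[atTop] fun t => Real.exp (-γ * t) := by
  have hgd : ∀ i, g i i = 0 := fun i => by linarith [hg i i]
  let x : ι × ι → ℝ → ℝ := fun p t => if p.1 = p.2 then 0 else h p.1 p.2 t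
  let y : ι → ℝ → ℝ := fun i t => h i i t - α i
  let lam : ι × ι → ℝ := fun p => if p.1 = p.2 then 1 else g p.1 p.2 * (α p.1 - α p.2)
  let r : ι × ι → ℝ → ℝ := fun p t => if p.1 = p.2 then 0 else
    g p.1 p.2 * (y p.1 t - y p.2 t) * x p t +
      ∑ k, (g k p.2 - g p.1 k) * (x (p.1, k) t * x (k, p.2) t)
  let X : ℝ → ℝ := fun t => ∑ q, |x q t|
  let Y : ℝ → ℝ := fun t => ∑ i, |y i t|
  let M : ℝ := ∑ p : ι × ι, |g p.1 p.2|
  let δ : ℝ → ℝ := fun t => 2 * M * (Y t + X t)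
  have hM0 : 0 ≤ M := Finset.sum_nonneg fun _ _ => abs_nonneg _
  have hX0 : ∀ t, 0 ≤ X t := fun t => Finset.sum_nonneg fun _ _ => abs_nonneg _
  have hY0 : ∀ t, 0 ≤ Y t := fun t => Finset.sum_nonneg fun _ _ => abs_nonneg _
  have hgM : ∀ i j, |g i j| ≤ M := fun i j =>
    Finset.single_le_sum (f := fun p : ι × ι => |g p.1 p.2|) (fun _ _ => abs_nonneg _)
      (Finset.mem_univ (i, j))
  have hxX : ∀ p t, |x p t| ≤ X t := fun p t =>
    Finset.single_le_sum (f := fun p => |x p t|) (fun _ _ => abs_nonneg _) (Finset.mem_univ p)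
  have hyY : ∀ i t, |y i t| ≤ Y t := fun i t =>
    Finset.single_le_sum (f := fun i => |y i t|) (fun _ _ => abs_nonneg _) (Finset.mem_univ i)
  have hcoef : ∀ i j k, |g k j - g i k| ≤ 2 * M := fun i j k =>
    (abs_sub _ _).trans (by linarith [hgM k j, hgM i k])
  have hrow : ∀ i t, ∑ k, |x (i, k) t| ≤ X t := by
    intro i t
    simp only [X, Fintype.sum_prod_type]
    exact Finset.single_le_sum (f := fun i => ∑ k, |x (i, k) t|)
      (fun _ _ => Finset.sum_nonneg fun _ _ => abs_nonneg _) (Finset.mem_univ i)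
  have hquad : ∀ i j t, |∑ k, (g k j - g i k) * (x (i, k) t * x (k, j) t)| ≤
      2 * M * X t ^ 2 := by
    intro i j t
    calc _ ≤ ∑ k, |(g k j - g i k) * (x (i, k) t * x (k, j) t)| := Finset.abs_sum_le_sum_abs _ _
      _ ≤ ∑ k, 2 * M * (|x (i, k) t| * X t) := by
          refine Finset.sum_le_sum fun k _ => ?_
          rw [abs_mul, abs_mul]
          have := hcoef i j k
          have := hxX (k, j) t
          gcongr
      _ = 2 * M * ((∑ k, |x (i, k) t|) * X t) := by rw [← Finset.mul_sum, Finset.sum_mul]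
      _ ≤ 2 * M * (X t * X t) := by
          have := hrow i t
          have := hX0 t
          gcongr
      _ = _ := by ring
  have hentry : ∀ i k t, h i k t = x (i, k) t + if i = k then h i i t else 0 := by
    intro i k t
    by_cases hik : i = k
    · subst hik; simp [x]
    · simp [x, hik]
  have hydiff : ∀ i, ∀ᶠ t in atTop,
      HasDerivAt (y i) (∑ k, (g k i - g i k) * (x (i, k) t * x (k, i) t)) t := by
    intro i
    filter_upwards [hh i i] with t ht
    refine (ht.sub_const (α i)).congr_deriv (Finset.sum_congr rfl fun k _ => ?_)
    by_cases hik : i = k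
    · subst hik; simp
    · simp [x, hik, Ne.symm hik]
  have hxdiff : ∀ p, ∀ᶠ t in atTop, HasDerivAt (x p) (lam p * x p t + r p t) t := by
    rintro ⟨i, j⟩
    by_cases hij : i = j
    · subst hij
      refine Eventually.of_forall fun t => ?_
      simpa [x, r] using hasDerivAt_const (F := ℝ) t 0
    · filter_upwards [hh i j] with t ht
      have hx : x (i, j) = h i j := by ext; simp [x, hij]
      rw [hx]
      refine ht.congr_deriv ?_
      have hexp : ∀ k, (g k j - g i k) * (h i k t * h k j t) =
          (g k j - g i k) * (x (i, k) t * x (k, j) t) +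
          (if i = k then g i j * h i i t * h i j t else 0) -
          (if k = j then g i j * h j j t * h i j t else 0) := by
        intro k
        by_cases hik : i = k
        · subst hik
          simp [x, hij, hgd]
          ring
        · by_cases hkj : k = j
          · subst hkj
            simp [x, hij, hgd]
            ring
          · simp [x, hik, hkj]
      simp only [hexp, Finset.sum_sub_distrib, Finset.sum_add_distrib, Finset.sum_ite_eq,
        Finset.sum_ite_eq', Finset.mem_univ, if_true]
      simp only [lam, r, y, hx, if_neg hij]
      ring
  have hr : ∀ p t, |r p t| ≤ δ t * ∑ q, |x q t| := by
    rintro ⟨i, j⟩ t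
    change _ ≤ 2 * M * (Y t + X t) * X t
    by_cases hij : i = j
    · have := hX0 t
      have := hY0 t
      simp only [r, if_pos hij, abs_zero]
      positivity
    · simp only [r, if_neg hij]
      have h1 : |g i j * (y i t - y j t) * x (i, j) t| ≤ M * (2 * Y t) * X t := by
        rw [abs_mul, abs_mul]
        have h2 := hgM i j
        have h3 := hxX (i, j) t
        have h4 : |y i t - y j t| ≤ 2 * Y t :=
          (abs_sub _ _).trans (by linarith [hyY i t, hyY j t])
        have := hY0 t
        gcongr
      refine (abs_add_le _ _).trans ((add_le_add h1 (hquad i j t)).trans (le_of_eq ?_))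
      ring
  have hx0 : ∀ p, Tendsto (x p) atTop (nhds 0) := by
    rintro ⟨i, j⟩
    by_cases hij : i = j
    · simp [x, hij]
    · simpa [x, hij] using hlim i j
  have hy0 : ∀ i, Tendsto (y i) atTop (nhds 0) := fun i => by
    simpa [y] using (hlim i i).sub_const (α i)
  have hδlim : Tendsto δ atTop (nhds 0) := by
    have hX : Tendsto X atTop (nhds (∑ q : ι × ι, |(0 : ℝ)|)) :=
      tendsto_finsetSum _ fun q _ => (hx0 q).abs
    have hY : Tendsto Y atTop (nhds (∑ i : ι, |(0 : ℝ)|)) :=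
      tendsto_finsetSum _ fun i _ => (hy0 i).abs
    simpa using (hY.add hX).const_mul (2 * M)
  have hδ0 : ∀ t, 0 ≤ δ t := fun t => by
    have := hX0 t
    have := hY0 t
    positivity
  have hlam : ∀ p, lam p ≠ 0 := by
    rintro ⟨i, j⟩
    by_cases hij : i = j
    · simp [lam, hij]
    · simpa [lam, hij] using ⟨hg0 i j hij, sub_ne_zero.2 (hα.ne hij)⟩
  have hlamneg : ∀ p, lam p < 0 → lam p ≤ -γ := by
    rintro ⟨i, j⟩
    by_cases hij : i = j
    · simp [lam, hij, not_lt.2 zero_le_one]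
    · simpa only [lam, if_neg hij] using hneg i j
  have hxhalf := isBigO_exp_half_of_hyperbolic hγ hlam hlamneg hxdiff
    (fun p => Eventually.of_forall (hr p)) hx0 hδlim hδ0
  have hXhalf : X =O[atTop] fun t => Real.exp (-(γ / 2) * t) :=
    Asymptotics.IsBigO.fun_sum fun q _ => (hxhalf q).abs_left
  have hydecay : ∀ i, y i =O[atTop] fun t => Real.exp (-γ * t) := by
    intro i
    refine isBigO_exp_of_deriv_isBigO_exp hγ (hydiff i) (hy0 i) ?_
    have h1 : (fun t => X t ^ 2) =O[atTop] fun t => Real.exp (-γ * t) := by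
      have h2 : (fun t => Real.exp (-γ * t)) = fun t => Real.exp (-(γ / 2) * t) ^ 2 := by
        ext t
        rw [← Real.exp_nat_mul]
        congr 1
        push_cast
        ring
      rw [h2]
      exact hXhalf.pow 2
    refine (Asymptotics.IsBigO.of_bound (2 * M) (Eventually.of_forall fun t => ?_)).trans h1
    simpa using hquad i i t
  have hexp : (fun t => Real.exp (-γ * t)) =O[atTop] fun t => Real.exp (-(γ / 2) * t) := by
    refine Asymptotics.IsBigO.of_bound 1 ?_
    filter_upwards [eventually_ge_atTop 0] with t ht
    rw [Real.norm_eq_abs, Real.norm_eq_abs, Real.abs_exp, Real.abs_exp, one_mul]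
    exact Real.exp_le_exp.2 (by nlinarith)
  have hYhalf : Y =O[atTop] fun t => Real.exp (-(γ / 2) * t) :=
    Asymptotics.IsBigO.fun_sum fun i _ => ((hydecay i).trans hexp).abs_left
  have hδhalf : δ =O[atTop] fun t => Real.exp (-(γ / 2) * t) :=
    (hYhalf.add hXhalf).const_mul_left _
  by_cases hij : i = j
  · subst hij
    simpa using hydecay i
  · simpa [x, hij] using isBigO_exp_of_hyperbolic hγ hlam hlamneg hxdiff
      (fun p => Eventually.of_forall (hr p)) hx0 hδlim hδ0 (half_pos hγ) hδhalf (i, j)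

/-- finite dimension: exponential convergence rate. Under the assumptions
of Statement 9, if in addition the eigenvalues of `H₀` are simple, then there are `T, C > 0`
with `‖H(t) − H∞‖ ≤ C e^{−γ t}` for all `t ≥ T`, where
`γ = inf_{𝒯⁻} |g i j * (α i − α j)| > 0` and
`𝒯⁻ = {(i,j) : i < j ∧ g i j * (α i − α j) < 0}`. -/
theorem stmt10
    {𝓗 : Type*} [NormedAddCommGroup 𝓗] [InnerProductSpace ℝ 𝓗] [FiniteDimensional ℝ 𝓗]
    {d : ℕ} (e : OrthonormalBasis (Fin d) ℝ 𝓗)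
    (G : (𝓗 →L[ℝ] 𝓗) → (𝓗 →L[ℝ] 𝓗))
    (hGadd : ∀ A B, G (A + B) = G A + G B)
    (hGsmul : ∀ (c : ℝ) A, G (c • A) = c • G A)
    (hGskew : ∀ A : 𝓗 →L[ℝ] 𝓗, (∀ x y, ⟪A x, y⟫ = ⟪x, A y⟫) →
      ∀ x y, ⟪G A x, y⟫ = -⟪x, G A y⟫)
    (g : Fin d → Fin d → ℝ)
    (hgskew : ∀ i j, g j i = -g i j)
    (hGdiag : ∀ i j, G (EsymF e i j) = g i j • EskewF e i j)
    (ε : Fin d → ℝ) (hε : ∀ ℓ, ε ℓ = 1 ∨ ε ℓ = -1)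
    (hsign : ∀ k ℓ : Fin d, ℓ ≤ k → 0 ≤ ε ℓ * g ℓ k)
    (hnonzero : ∀ ℓ j : Fin d, j ≠ ℓ → g ℓ j ≠ 0)
    (H₀ : 𝓗 →L[ℝ] 𝓗)
    (hH₀sym : ∀ x y, ⟪H₀ x, y⟫ = ⟪x, H₀ y⟫)
    -- the eigenvalues of `H₀` are simple
    (hsimple : ∃ (f : OrthonormalBasis (Fin d) ℝ 𝓗) (β : Fin d → ℝ),
      Function.Injective β ∧ ∀ ℓ, H₀ (f ℓ) = β ℓ • f ℓ)
    -- `H` is the solution of the Cauchy problem on `[0,∞)`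
    (H : ℝ → 𝓗 →L[ℝ] 𝓗)
    (hH0 : H 0 = H₀)
    (hODE : ∀ t ∈ Ici (0 : ℝ),
      HasDerivWithinAt H (H t * G (H t) - G (H t) * H t) (Ici 0) t)
    -- `H∞ = diag(α)` is the limit of the solution
    (Hinf : 𝓗 →L[ℝ] 𝓗) (α : Fin d → ℝ)
    (hdiag : ∀ ℓ, Hinf (e ℓ) = α ℓ • e ℓ)
    (hconv : Tendsto H atTop (nhds Hinf))
    -- `γ` is the infimum over `𝒯⁻` of `|g i j * (α i − α j)|`
    (γ : ℝ)
    (hγ : γ = sInf {x : ℝ | ∃ i j : Fin d, i < j ∧ g i j * (α i - α j) < 0 ∧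
      x = |g i j * (α i - α j)|}) :
    ((∃ i j : Fin d, i < j ∧ g i j * (α i - α j) < 0) → 0 < γ) ∧
    ∃ T C : ℝ, 0 < T ∧ 0 < C ∧ ∀ t ≥ T, ‖H t - Hinf‖ ≤ C * Real.exp (-γ * t) := by
  set Tneg : Set ℝ := {x : ℝ | ∃ i j : Fin d, i < j ∧ g i j * (α i - α j) < 0 ∧
    x = |g i j * (α i - α j)|} with hTneg
  have hfin : Tneg.Finite :=
    (Set.finite_range fun p : Fin d × Fin d => |g p.1 p.2 * (α p.1 - α p.2)|).subset
      fun x ⟨i, j, _, _, hx⟩ => ⟨(i, j), hx.symm⟩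
  have hpos : (∃ i j : Fin d, i < j ∧ g i j * (α i - α j) < 0) → 0 < γ := by
    rintro ⟨i, j, hij, hneg⟩
    have hne : Tneg.Nonempty := ⟨_, i, j, hij, hneg, rfl⟩
    obtain ⟨i', j', -, hneg', hx⟩ := hne.csInf_mem hfin
    rw [hγ, hx]
    exact abs_pos.2 hneg'.ne
  have hneg : ∀ i j, g i j * (α i - α j) < 0 → g i j * (α i - α j) ≤ -γ := by
    have hlt : ∀ i j, i < j → g i j * (α i - α j) < 0 → g i j * (α i - α j) ≤ -γ := by
      intro i j hij h
      have : γ ≤ |g i j * (α i - α j)| := hγ ▸ csInf_le hfin.bddBelow ⟨i, j, hij, h, rfl⟩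
      rw [abs_of_neg h] at this
      linarith
    intro i j h
    rcases lt_trichotomy i j with hij | rfl | hij
    · exact hlt i j hij h
    · simp at h
    · have hswap : g i j * (α i - α j) = g j i * (α j - α i) := by rw [hgskew j i]; ring
      rw [hswap] at h ⊢
      exact hlt j i hij h
  refine ⟨hpos, ?_⟩
  suffices hO : (fun t => H t - Hinf) =O[atTop] fun t => Real.exp (-γ * t) by
    obtain ⟨C, hC, hb⟩ := hO.exists_pos
    obtain ⟨T, hT⟩ := eventually_atTop.1 hb.bound
    refine ⟨max T 1, C, by positivity, hC, fun t ht => ?_⟩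
    simpa [abs_of_pos, Real.exp_pos] using hT t ((le_max_left T 1).trans ht)
  by_cases hT : ∃ i j : Fin d, i < j ∧ g i j * (α i - α j) < 0
  swap
  · have hempty : Tneg = ∅ := by
      ext x
      simp only [hTneg, mem_ofPred_eq, mem_empty_iff_false, iff_false]
      rintro ⟨i, j, hij, h, -⟩
      exact hT ⟨i, j, hij, h⟩
    have h0 : γ = 0 := by rw [hγ, hempty, Real.sInf_empty]
    simpa [h0] using (hconv.sub_const Hinf).isBigO_one ℝ
  have hγ0 := hpos hT
  let L : (𝓗 →L[ℝ] 𝓗) →ₗ[ℝ] (𝓗 →L[ℝ] 𝓗) :=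
    { toFun := G, map_add' := hGadd, map_smul' := hGsmul }
  have hsymm : ∀ t, 0 ≤ t → ∀ x y, ⟪H t x, y⟫ = ⟪x, H t y⟫ := fun t ht =>
    symmetric_of_bracket_flow L hGskew (hH0 ▸ hH₀sym) hODE ht
  have hα : Function.Injective α := by
    obtain ⟨f, β, hβ, hf⟩ := hsimple
    refine injective_of_sum_pow_eq hβ fun n => ?_
    rw [← trace_pow_of_eigenbasis e hdiag, ← trace_pow_of_eigenbasis f hf, ← hH0]
    let τ : (𝓗 →L[ℝ] 𝓗) →L[ℝ] ℝ :=
      ((LinearMap.trace ℝ 𝓗).comp (coeLM ℝ)).toContinuousLinearMap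
    have h1 : Tendsto (fun t => τ (H t ^ n)) atTop (nhds (τ (Hinf ^ n))) :=
      (τ.continuous.tendsto _).comp (hconv.pow n)
    refine tendsto_nhds_unique h1 (tendsto_const_nhds.congr' ?_)
    filter_upwards [eventually_ge_atTop 0] with t ht
    exact (trace_pow_eq_of_bracket_flow hODE n ht).symm
  let entry : Fin d → Fin d → (𝓗 →L[ℝ] 𝓗) →L[ℝ] ℝ := fun i j =>
    (innerSL ℝ (e i)).comp (ContinuousLinearMap.apply ℝ 𝓗 (e j))
  have hentry : ∀ i j A, entry i j A = ⟪e i, A (e j)⟫ := fun i j A => rfl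
  have hmul : ∀ i j (A B : 𝓗 →L[ℝ] 𝓗),
      entry i j (A * B) = ∑ k, entry i k A * entry k j B := by
    intro i j A B
    simp only [hentry, mul_apply_eq_comp]
    conv_lhs => rw [← e.sum_repr' (B (e j)), map_sum, inner_sum]
    exact Finset.sum_congr rfl fun k _ => by rw [map_smul, inner_smul_right, mul_comm]
  have hentryG : ∀ t, 0 ≤ t → ∀ i j, entry i j (G (H t)) = g i j * entry i j (H t) :=
    fun t ht => inner_diagonalizable_apply e L hgskew hGdiag (hsymm t ht)
  have hinf : ∀ i j, entry i j Hinf = if i = j then α i else 0 := by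
    intro i j
    rw [hentry, hdiag, inner_smul_right, orthonormal_iff_ite.1 e.orthonormal]
    split_ifs with hij <;> simp [hij]
  have hO := isBigO_exp_entry (h := fun i j t => entry i j (H t)) hγ0 hgskew
    (fun i j hij => hnonzero i j hij.symm) hα hneg
    (fun i j => by
      filter_upwards [eventually_gt_atTop 0] with t ht
      have h1 := (hODE t ht.le).hasDerivAt (Ici_mem_nhds ht)
      refine ((entry i j).hasFDerivAt.comp_hasDerivAt t h1).congr_deriv ?_
      rw [map_sub, hmul, hmul, ← Finset.sum_sub_distrib]
      refine Finset.sum_congr rfl fun k _ => ?_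
      rw [hentryG t ht.le, hentryG t ht.le]
      ring)
    (fun i j => by
      rw [← hinf]
      exact ((entry i j).continuous.tendsto _).comp hconv)
  refine Asymptotics.IsBigO.trans (Asymptotics.IsBigO.of_bound 1 (Eventually.of_forall fun t => ?_))
    (Asymptotics.IsBigO.fun_sum fun i (_ : i ∈ Finset.univ) =>
      Asymptotics.IsBigO.fun_sum fun j (_ : j ∈ Finset.univ) => (hO i j).abs_left)
  rw [one_mul]
  refine (norm_le_sum_abs_inner e _).trans ((le_of_eq ?_).trans (le_abs_self _))
  refine Finset.sum_congr rfl fun i _ => Finset.sum_congr rfl fun j _ => ?_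
  rw [← hinf, ← map_sub, hentry]
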